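/- Let d₁ ≥ r ≥ 1 and let A ∈ ℝ^{d₁×r} satisfy ‖AᵀA − I_r‖₂ ≤ δ. Let S ∈ ℝ^{r×r} be the positive semidefinite square root of AᵀA, and let U ∈ ℝ^{d₁×r} be any matrix with UᵀU = I_r and A = U·S (such a U exists: if A = Ũ₁D̃Ũ₂ᵀ is a singular value decomposition then U = Ũ₁Ũ₂ᵀ works). Then for every positive semidefinite matrix Λ ∈ ℝ^{r×r}, ‖AΛAᵀ − UΛUᵀ‖₂ ≤ δ·‖Λ‖₂. -/

import Mathlib

open Matrix

/-- Spectral norm (largest singular value): operator norm of the induced map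
between Euclidean spaces. -/
noncomputable def specNorm {m n : Type*} [Fintype m] [Fintype n] [DecidableEq n]
    (M : Matrix m n ℝ) : ℝ :=
  ‖LinearMap.toContinuousLinearMap (Matrix.toEuclideanLin M)‖

/-- Euclidean norm of a vector. -/
noncomputable def euclNorm {n : Type*} [Fintype n] (x : n → ℝ) : ℝ :=
  Real.sqrt (∑ i, x i ^ 2)

lemma aux_dot_norm {n : ℕ} (x : Fin n → ℝ) : x ⬝ᵥ x = ‖WithLp.toLp 2 x‖ ^ 2 := by
  rw [EuclideanSpace.norm_sq_eq]
  simp [dotProduct, sq]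

lemma aux_dot_inner {n : ℕ} (x y : Fin n → ℝ) :
    x ⬝ᵥ y = inner ℝ (WithLp.toLp 2 x) (WithLp.toLp 2 y) := by
  simp [PiLp.inner_apply, dotProduct, mul_comm]

lemma aux_norm_le {m n : ℕ} (M : Matrix (Fin m) (Fin n) ℝ) (x : Fin n → ℝ) :
    ‖WithLp.toLp 2 (M *ᵥ x)‖ ≤ specNorm M * ‖WithLp.toLp 2 x‖ :=
  (LinearMap.toContinuousLinearMap (Matrix.toEuclideanLin M)).le_opNorm (WithLp.toLp 2 x)

lemma aux_quad_le {n : ℕ} (M : Matrix (Fin n) (Fin n) ℝ) (x : Fin n → ℝ) :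
    |x ⬝ᵥ (M *ᵥ x)| ≤ specNorm M * (x ⬝ᵥ x) := by
  rw [aux_dot_norm, aux_dot_inner]
  refine (abs_real_inner_le_norm _ _).trans ?_
  have := mul_le_mul_of_nonneg_left (aux_norm_le M x) (norm_nonneg (WithLp.toLp 2 x))
  linarith

/-- Quadratic functional calculus for a symmetric matrix. -/
lemma aux_quad {n : ℕ} (S : Matrix (Fin n) (Fin n) ℝ) (hS : S.IsHermitian) (α β γ : ℝ)
    (h : ∀ (s : ℝ) (v : Fin n → ℝ), v ⬝ᵥ v = 1 → S *ᵥ v = s • v → 0 ≤ α + β * s + γ * s ^ 2)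
    (x : Fin n → ℝ) :
    0 ≤ α * (x ⬝ᵥ x) + β * (x ⬝ᵥ (S *ᵥ x)) + γ * ((S *ᵥ x) ⬝ᵥ (S *ᵥ x)) := by
  have hT : Sᵀ = S := by simpa [conjTranspose_eq_transpose_of_trivial] using hS.eq
  let b := hS.eigenvectorBasis
  have hb : ∀ i, S *ᵥ (b i).ofLp = hS.eigenvalues i • (b i).ofLp := fun i =>
    hS.mulVec_eigenvectorBasis i
  have key : ∀ y z : Fin n → ℝ, y ⬝ᵥ z = ∑ i, (y ⬝ᵥ (b i).ofLp) * ((b i).ofLp ⬝ᵥ z) := by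
    intro y z
    simp only [aux_dot_inner]
    exact (b.sum_inner_mul_inner _ _).symm
  have hsym : ∀ i, (b i).ofLp ⬝ᵥ (S *ᵥ x) = hS.eigenvalues i * ((b i).ofLp ⬝ᵥ x) := by
    intro i
    rw [dotProduct_mulVec, ← mulVec_transpose, hT, hb, smul_dotProduct, smul_eq_mul]
  rw [key x x, key x (S *ᵥ x), key (S *ᵥ x) (S *ᵥ x)]
  simp only [hsym, dotProduct_comm _ (b _).ofLp, Finset.mul_sum, ← Finset.sum_add_distrib]
  refine Finset.sum_nonneg fun i _ => ?_
  have h1 := h (hS.eigenvalues i) (b i).ofLp (by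
    rw [aux_dot_norm]; simp [b.norm_eq_one]) (hb i)
  have := mul_nonneg h1 (sq_nonneg ((b i).ofLp ⬝ᵥ x))
  linarith

lemma aux_specNorm_le {n : ℕ} (M : Matrix (Fin n) (Fin n) ℝ) (hM : M.IsHermitian) (c : ℝ)
    (hc : 0 ≤ c) (h : ∀ x : Fin n → ℝ, |x ⬝ᵥ (M *ᵥ x)| ≤ c * (x ⬝ᵥ x)) : specNorm M ≤ c := by
  refine ContinuousLinearMap.opNorm_le_bound _ hc fun x => ?_
  have h1 := aux_quad M hM (c ^ 2) 0 (-1) (fun s v hv hs => by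
    have := h v
    rw [hs, dotProduct_smul, hv, smul_eq_mul, mul_one, mul_one] at this
    have := sq_le_sq' (abs_le.1 this).1 (abs_le.1 this).2
    linarith) x.ofLp
  rw [aux_dot_norm, aux_dot_norm] at h1
  change ‖WithLp.toLp 2 (M *ᵥ x.ofLp)‖ ≤ c * ‖WithLp.toLp 2 x.ofLp‖
  refine le_of_sq_le_sq ?_ (by positivity)
  rw [mul_pow]; linarith

/-- Young type inequality for a positive semidefinite matrix. -/
lemma aux_young {n : ℕ} (Q : Matrix (Fin n) (Fin n) ℝ) (hT : Qᵀ = Q)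
    (hQ : ∀ x : Fin n → ℝ, 0 ≤ x ⬝ᵥ (Q *ᵥ x)) (a δ : ℝ) (hδ : 0 < δ) (x y : Fin n → ℝ) :
    2 * a * (x ⬝ᵥ (Q *ᵥ y)) ≤ δ * (x ⬝ᵥ (Q *ᵥ x)) + a ^ 2 / δ * (y ⬝ᵥ (Q *ᵥ y)) := by
  have h := hQ (δ • x - a • y)
  have hs : y ⬝ᵥ (Q *ᵥ x) = x ⬝ᵥ (Q *ᵥ y) := by
    rw [dotProduct_mulVec, ← mulVec_transpose, hT, dotProduct_comm]
  simp only [mulVec_sub, mulVec_smul, sub_dotProduct, dotProduct_sub, smul_dotProduct,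
    dotProduct_smul, smul_eq_mul, hs] at h
  have h2 : 0 ≤ (1 / δ) * (δ ^ 2 * (x ⬝ᵥ (Q *ᵥ x)) - 2 * a * δ * (x ⬝ᵥ (Q *ᵥ y))
      + a ^ 2 * (y ⬝ᵥ (Q *ᵥ y))) := mul_nonneg (by positivity) (by linarith)
  have h3 : (1 / δ) * (δ ^ 2 * (x ⬝ᵥ (Q *ᵥ x)) - 2 * a * δ * (x ⬝ᵥ (Q *ᵥ y))
      + a ^ 2 * (y ⬝ᵥ (Q *ᵥ y))) = δ * (x ⬝ᵥ (Q *ᵥ x)) - 2 * a * (x ⬝ᵥ (Q *ᵥ y))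
      + a ^ 2 / δ * (y ⬝ᵥ (Q *ᵥ y)) := by field_simp
  linarith

/-- The core two-sided quadratic form bound. -/
lemma aux_core {n : ℕ} (S Λ : Matrix (Fin n) (Fin n) ℝ) (δ L : ℝ) (hδ : 0 < δ)
    (hS : S.PosSemidef) (hΛ : Λ.PosSemidef)
    (hL : ∀ x : Fin n → ℝ, x ⬝ᵥ (Λ *ᵥ x) ≤ L * (x ⬝ᵥ x)) (hL0 : 0 ≤ L)
    (hSδ : ∀ x : Fin n → ℝ, |(S *ᵥ x) ⬝ᵥ (S *ᵥ x) - x ⬝ᵥ x| ≤ δ * (x ⬝ᵥ x))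
    (x : Fin n → ℝ) :
    |(S *ᵥ x) ⬝ᵥ (Λ *ᵥ (S *ᵥ x)) - x ⬝ᵥ (Λ *ᵥ x)| ≤ δ * L * (x ⬝ᵥ x) := by
  have hΛT : Λᵀ = Λ := by simpa [conjTranspose_eq_transpose_of_trivial] using hΛ.1.eq
  have hΛ0 : ∀ x : Fin n → ℝ, 0 ≤ x ⬝ᵥ (Λ *ᵥ x) := fun x => by
    simpa using hΛ.dotProduct_mulVec_nonneg x
  have hS0 : ∀ x : Fin n → ℝ, 0 ≤ x ⬝ᵥ (S *ᵥ x) := fun x => by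
    simpa using hS.dotProduct_mulVec_nonneg x
  have hev : ∀ (s : ℝ) (v : Fin n → ℝ), v ⬝ᵥ v = 1 → S *ᵥ v = s • v →
      0 ≤ s ∧ s ^ 2 ≤ 1 + δ ∧ 1 - δ ≤ s ^ 2 := by
    intro s v hv hs
    have h1 := hS0 v
    have h2 := hSδ v
    simp only [hs, dotProduct_smul, smul_dotProduct, hv, smul_eq_mul, mul_one] at h1 h2
    have := abs_le.1 h2
    exact ⟨h1, by nlinarith, by nlinarith⟩
  set Q : Matrix (Fin n) (Fin n) ℝ := L • 1 - Λ with hQ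
  have hQv : ∀ u w : Fin n → ℝ, u ⬝ᵥ (Q *ᵥ w) = L * (u ⬝ᵥ w) - u ⬝ᵥ (Λ *ᵥ w) := by
    intro u w
    simp [hQ, sub_mulVec, smul_mulVec, dotProduct_sub, dotProduct_smul]
  have hQT : Qᵀ = Q := by simp [hQ, hΛT]
  have hQ0 : ∀ x : Fin n → ℝ, 0 ≤ x ⬝ᵥ (Q *ᵥ x) := fun x => by
    rw [hQv]; linarith [hL x]
  have hcomm : (S *ᵥ x) ⬝ᵥ (Λ *ᵥ x) = x ⬝ᵥ (Λ *ᵥ (S *ᵥ x)) := by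
    rw [dotProduct_mulVec, ← mulVec_transpose, hΛT, dotProduct_comm]
  have hxx : 0 ≤ x ⬝ᵥ x := by rw [aux_dot_norm]; positivity
  rw [abs_le]
  constructor
  · rcases le_or_gt 1 δ with h1 | h1
    · have := hΛ0 (S *ᵥ x)
      have := hL x
      have := mul_nonneg (mul_nonneg hL0 hxx) (sub_nonneg.2 h1)
      linarith
    · obtain ⟨b, hb0, hb⟩ : ∃ b : ℝ, 0 ≤ b ∧ b ^ 2 = 1 - δ :=
        ⟨√(1 - δ), Real.sqrt_nonneg _, Real.sq_sqrt (by linarith)⟩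
      have hq := aux_quad S hS.1 (-b * (2 - b ^ 2)) 2 (-b) (fun s v hv hs => by
        obtain ⟨h2, h3, h4⟩ := hev s v hv hs
        have h5 : b ≤ s := le_of_sq_le_sq (by linarith) h2
        have h6 : 0 ≤ 2 - b * s - b ^ 2 := by nlinarith [sq_nonneg (b - s)]
        nlinarith [mul_nonneg (sub_nonneg.2 h5) h6]) x
      have hy := aux_young Q hQT hQ0 b δ hδ x (S *ᵥ x - b • x)
      have hy0 := hΛ0 (S *ᵥ x - b • x)
      have hyQ := hL (S *ᵥ x - b • x)
      simp only [hQv, mulVec_sub, mulVec_smul, sub_dotProduct, dotProduct_sub, smul_dotProduct,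
        dotProduct_smul, smul_eq_mul, hcomm, dotProduct_comm (S *ᵥ x) x] at hy hy0 hyQ
      generalize x ⬝ᵥ x = X at *
      generalize x ⬝ᵥ (S *ᵥ x) = Y at *
      generalize (S *ᵥ x) ⬝ᵥ (S *ᵥ x) = Z at *
      generalize x ⬝ᵥ (Λ *ᵥ x) = p at *
      generalize x ⬝ᵥ (Λ *ᵥ (S *ᵥ x)) = q at *
      generalize (S *ᵥ x) ⬝ᵥ (Λ *ᵥ (S *ᵥ x)) = t at *
      have hk : b * (Z - 2 * b * Y + b ^ 2 * X) ≤ 2 * δ * (Y - b * X) := by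
        have : δ = 1 - b ^ 2 := by linarith
        rw [this]; linarith
      have hk2 := mul_le_mul_of_nonneg_left hk (show 0 ≤ b / δ * L by positivity)
      have e1 : b / δ * L * (b * (Z - 2 * b * Y + b ^ 2 * X))
          = b ^ 2 / δ * (L * (Z - 2 * b * Y + b ^ 2 * X)) := by ring
      have e2 : b / δ * L * (2 * δ * (Y - b * X)) = 2 * b * L * (Y - b * X) := by field_simp
      rw [e1, e2] at hk2
      have hm := mul_nonneg (show 0 ≤ b ^ 2 / δ by positivity) hy0
      have hbp : b ^ 2 * p = (1 - δ) * p := by rw [hb]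
      linarith
  · obtain ⟨a, ha0, ha⟩ : ∃ a : ℝ, 0 < a ∧ a ^ 2 = 1 + δ :=
      ⟨√(1 + δ), Real.sqrt_pos.2 (by linarith), Real.sq_sqrt (by linarith)⟩
    have hq := aux_quad S hS.1 (a * (a ^ 2 - 2)) 2 (-a) (fun s v hv hs => by
      obtain ⟨h2, h3, h4⟩ := hev s v hv hs
      have h5 : s ≤ a := le_of_sq_le_sq (by linarith) ha0.le
      have h6 : 0 ≤ a ^ 2 + a * s - 2 := by nlinarith [mul_nonneg h2 (sub_nonneg.2 h5)]
      nlinarith [mul_nonneg (sub_nonneg.2 h5) h6]) x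
    have hy := aux_young Q hQT hQ0 a δ hδ x (a • x - S *ᵥ x)
    have hy0 := hΛ0 (a • x - S *ᵥ x)
    simp only [hQv, mulVec_sub, mulVec_smul, sub_dotProduct, dotProduct_sub, smul_dotProduct,
      dotProduct_smul, smul_eq_mul, hcomm, dotProduct_comm (S *ᵥ x) x] at hy hy0
    generalize x ⬝ᵥ x = X at *
    generalize x ⬝ᵥ (S *ᵥ x) = Y at *
    generalize (S *ᵥ x) ⬝ᵥ (S *ᵥ x) = Z at *
    generalize x ⬝ᵥ (Λ *ᵥ x) = p at *
    generalize x ⬝ᵥ (Λ *ᵥ (S *ᵥ x)) = q at *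
    generalize (S *ᵥ x) ⬝ᵥ (Λ *ᵥ (S *ᵥ x)) = t at *
    have hk : a * (Z - 2 * a * Y + a ^ 2 * X) ≤ 2 * δ * (a * X - Y) := by
      have : δ = a ^ 2 - 1 := by linarith
      rw [this]; linarith
    have hk2 := mul_le_mul_of_nonneg_left hk (show 0 ≤ a / δ * L by positivity)
    have e1 : a / δ * L * (a * (Z - 2 * a * Y + a ^ 2 * X))
        = a ^ 2 / δ * (L * (Z - 2 * a * Y + a ^ 2 * X)) := by ring
    have e2 : a / δ * L * (2 * δ * (a * X - Y)) = 2 * a * L * (a * X - Y) := by field_simp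
    rw [e1, e2] at hk2
    have hc : 0 ≤ a ^ 2 / δ - 1 := by
      rw [ha, sub_nonneg, le_div_iff₀ hδ]; linarith
    have hm := mul_nonneg hc hy0
    have hbp : a ^ 2 * p = (1 + δ) * p := by rw [ha]
    linarith

theorem stmt_0 {d₁ r : ℕ} (hr : 1 ≤ r) (hrd : r ≤ d₁) {δ : ℝ}
    (A U : Matrix (Fin d₁) (Fin r) ℝ) (S : Matrix (Fin r) (Fin r) ℝ)
    (hδ : specNorm (Aᵀ * A - 1) ≤ δ)
    (hSpsd : S.PosSemidef) (hSsq : S * S = Aᵀ * A)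
    (hU : Uᵀ * U = 1) (hAU : A = U * S) :
    ∀ Λ : Matrix (Fin r) (Fin r) ℝ, Λ.PosSemidef →
      specNorm (A * Λ * Aᵀ - U * Λ * Uᵀ) ≤ δ * specNorm Λ := by
  intro Λ hΛ
  have hST : Sᵀ = S := by simpa [conjTranspose_eq_transpose_of_trivial] using hSpsd.1.eq
  have hΛT : Λᵀ = Λ := by simpa [conjTranspose_eq_transpose_of_trivial] using hΛ.1.eq
  have hδ0 : 0 ≤ δ := le_trans (norm_nonneg _) hδ
  have hL0 : 0 ≤ specNorm Λ := norm_nonneg _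
  have hnn : ∀ {k : ℕ} (x : Fin k → ℝ), 0 ≤ x ⬝ᵥ x := fun x => by
    rw [aux_dot_norm]; positivity
  have hL : ∀ x : Fin r → ℝ, x ⬝ᵥ (Λ *ᵥ x) ≤ specNorm Λ * (x ⬝ᵥ x) := fun x =>
    (le_abs_self _).trans (aux_quad_le Λ x)
  have hSδ : ∀ x : Fin r → ℝ, |(S *ᵥ x) ⬝ᵥ (S *ᵥ x) - x ⬝ᵥ x| ≤ δ * (x ⬝ᵥ x) := by
    intro x
    have h := aux_quad_le (Aᵀ * A - 1) x
    rw [← hSsq] at h hδ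
    have e : x ⬝ᵥ ((S * S - 1) *ᵥ x) = (S *ᵥ x) ⬝ᵥ (S *ᵥ x) - x ⬝ᵥ x := by
      rw [sub_mulVec, one_mulVec, dotProduct_sub, ← mulVec_mulVec, dotProduct_mulVec,
        ← mulVec_transpose, hST]
    rw [e] at h
    exact h.trans (mul_le_mul_of_nonneg_right hδ (hnn x))
  have hcore : ∀ x : Fin r → ℝ, |(S *ᵥ x) ⬝ᵥ (Λ *ᵥ (S *ᵥ x)) - x ⬝ᵥ (Λ *ᵥ x)|
      ≤ δ * specNorm Λ * (x ⬝ᵥ x) := by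
    intro x
    have hlim : Filter.Tendsto (fun e : ℝ => e * specNorm Λ * (x ⬝ᵥ x))
        (nhdsWithin δ (Set.Ioi δ)) (nhds (δ * specNorm Λ * (x ⬝ᵥ x))) :=
      ((by fun_prop : Continuous (fun e : ℝ => e * specNorm Λ * (x ⬝ᵥ x))).tendsto δ).mono_left
        nhdsWithin_le_nhds
    refine ge_of_tendsto hlim ?_
    filter_upwards [self_mem_nhdsWithin] with e he
    have he' : δ < e := he
    exact aux_core S Λ e (specNorm Λ) (by linarith) hSpsd hΛ hL hL0
      (fun x => (hSδ x).trans (mul_le_mul_of_nonneg_right he'.le (hnn x))) x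
  refine aux_specNorm_le _ ?_ _ (mul_nonneg hδ0 hL0) fun z => ?_
  · rw [Matrix.IsHermitian, conjTranspose_eq_transpose_of_trivial]
    simp [transpose_sub, transpose_mul, hΛT, Matrix.mul_assoc]
  · have hz : (Uᵀ *ᵥ z) ⬝ᵥ (Uᵀ *ᵥ z) ≤ z ⬝ᵥ z := by
      have h := hnn (z - U *ᵥ (Uᵀ *ᵥ z))
      have e1 : z ⬝ᵥ (U *ᵥ (Uᵀ *ᵥ z)) = (Uᵀ *ᵥ z) ⬝ᵥ (Uᵀ *ᵥ z) := by
        rw [dotProduct_mulVec, ← mulVec_transpose]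
      have e2 : (U *ᵥ (Uᵀ *ᵥ z)) ⬝ᵥ (U *ᵥ (Uᵀ *ᵥ z)) = (Uᵀ *ᵥ z) ⬝ᵥ (Uᵀ *ᵥ z) := by
        rw [dotProduct_mulVec, ← mulVec_transpose, mulVec_mulVec, hU, one_mulVec]
      rw [sub_dotProduct, dotProduct_sub, dotProduct_sub, dotProduct_comm (U *ᵥ (Uᵀ *ᵥ z)) z, e2, e1] at h
      linarith
    have e : z ⬝ᵥ ((A * Λ * Aᵀ - U * Λ * Uᵀ) *ᵥ z) =
        (S *ᵥ (Uᵀ *ᵥ z)) ⬝ᵥ (Λ *ᵥ (S *ᵥ (Uᵀ *ᵥ z))) - (Uᵀ *ᵥ z) ⬝ᵥ (Λ *ᵥ (Uᵀ *ᵥ z)) := by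
      rw [sub_mulVec, dotProduct_sub, hAU, transpose_mul, hST]
      simp only [← mulVec_mulVec]
      rw [dotProduct_mulVec z U, dotProduct_mulVec z U, ← mulVec_transpose,
        dotProduct_mulVec _ S, ← mulVec_transpose S, hST]
    rw [e]
    exact (hcore _).trans (mul_le_mul_of_nonneg_left hz (mul_nonneg hδ0 hL0))
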